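/- arXiv:1310.5026 — 5 statements merged into one kernel-verified Lean document; each statement's English description precedes it below -/
import Mathlib

section
/- Let K be a field of characteristic zero, D a finite-dimensional K-vector space, and φ : D → D a bijective K-linear endomorphism. Let F : ℤ → {subspaces of D} be a decreasing filtration (F(i+1) ⊆ F(i)) with F(i) = D for all sufficiently small i and F(i) = 0 for all sufficiently large i. Let B : D × D → K be a bilinear form satisfying B(φx, φy) = B(x, y) for all x, y ∈ D, and suppose that for every i ∈ ℤ one has F(i) = { x ∈ D : B(x, y) = 0 for all y ∈ F(1−i) } (in particular B is nondegenerate and identifies D with its filtered dual). Assume: (a) the operator T := φ + φ⁻¹ maps F(1) into F(1); (b) ker((φ − id)²) = ker(φ − id); (c) F(0) ∩ ker(φ − id) = 0. Then ker(φ − id) = 0. -/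
/-- Linear-algebra content of the paper's Proposition 1.1 on autodual crystalline
representations (case `K₀ = ℚ_p`, linear Frobenius). -/
theorem stmt0 (K : Type*) [Field K] [CharZero K]
    (D : Type*) [AddCommGroup D] [Module K D] [FiniteDimensional K D]
    (φ : D ≃ₗ[K] D)
    (F : ℤ → Submodule K D)
    (hFdec : ∀ i : ℤ, F (i + 1) ≤ F i)
    (hFbot : ∃ i₀ : ℤ, ∀ i ≥ i₀, F i = ⊥)
    (hFtop : ∃ i₁ : ℤ, ∀ i ≤ i₁, F i = ⊤)
    (B : D →ₗ[K] D →ₗ[K] K)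
    (hBφ : ∀ x y : D, B (φ x) (φ y) = B x y)
    (hdual : ∀ i : ℤ, ∀ x : D, x ∈ F i ↔ ∀ y ∈ F (1 - i), B x y = 0)
    (hT : ∀ x ∈ F 1, φ x + φ.symm x ∈ F 1)
    (hss : LinearMap.ker ((φ.toLinearMap - LinearMap.id) ∘ₗ (φ.toLinearMap - LinearMap.id))
        = LinearMap.ker (φ.toLinearMap - LinearMap.id))
    (hF0 : F 0 ⊓ LinearMap.ker (φ.toLinearMap - LinearMap.id) = ⊥) :
    LinearMap.ker (φ.toLinearMap - LinearMap.id) = ⊥ := by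
  have hadj : ∀ x y : D, B (φ x) y = B x (φ.symm y) := fun x y => by
    have := hBφ x (φ.symm y)
    simpa using this
  have hadj' : ∀ x y : D, B (φ.symm x) y = B x (φ y) := fun x y => by
    have := hBφ (φ.symm x) y
    simpa using this.symm
  have hT0 : ∀ x ∈ F 0, φ x + φ.symm x ∈ F 0 := by
    intro x hx
    rw [hdual 0]
    intro y hy
    have h := (hdual 0 x).1 hx (φ y + φ.symm y) (by simpa using hT y (by simpa using hy))
    rw [map_add, LinearMap.add_apply, hadj, hadj', add_comm, ← map_add]
    exact h
  let N : D →ₗ[K] D := φ.toLinearMap + φ.symm.toLinearMap - (2 : K) • LinearMap.id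
  have hN : ∀ x, N x = φ x + φ.symm x - (2 : K) • x := fun x => rfl
  have hN0 : ∀ x ∈ F 0, N x ∈ F 0 := fun x hx => by
    rw [hN]
    exact (F 0).sub_mem (hT0 x hx) ((F 0).smul_mem _ hx)
  have hker : ∀ x, N x = 0 → x ∈ LinearMap.ker (φ.toLinearMap - LinearMap.id) := by
    intro x hx
    rw [← hss]
    have h2 : φ (N x) = 0 := by rw [hx, map_zero]
    rw [hN] at h2
    simp only [map_add, map_sub, map_smul, LinearEquiv.apply_symm_apply, two_smul] at h2
    simp only [LinearMap.mem_ker, LinearMap.comp_apply, LinearMap.sub_apply,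
      LinearEquiv.coe_coe, LinearMap.id_apply, map_sub]
    rw [← h2]
    abel
  have hinj : Function.Injective (N.restrict hN0) := by
    rw [injective_iff_map_eq_zero]
    rintro ⟨x, hx⟩ h
    have h1 : N x = 0 := congrArg Subtype.val h
    have h2 : x ∈ F 0 ⊓ LinearMap.ker (φ.toLinearMap - LinearMap.id) := ⟨hx, hker x h1⟩
    rw [hF0, Submodule.mem_bot] at h2
    exact Subtype.ext h2
  have hsurj := LinearMap.injective_iff_surjective.1 hinj
  rw [eq_bot_iff]
  intro e he
  rw [← hF0]
  refine ⟨?_, he⟩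
  have hfix : φ e = e := by
    simpa [sub_eq_zero] using he
  have h1 : e ∈ F 1 := by
    rw [hdual 1]
    intro y hy
    obtain ⟨⟨z, hz⟩, h⟩ := hsurj ⟨y, by simpa using hy⟩
    have h1 : N z = y := congrArg Subtype.val h
    have h3 : B e (φ z) = B e z := by
      have := hBφ e z
      rwa [hfix] at this
    have h4 : B e (φ.symm z) = B e z := by rw [← hadj, hfix]
    rw [← h1, hN, map_sub, map_add, h3, h4, map_smul, two_smul, sub_self]
  exact hFdec 0 (by simpa using h1)
end

section
/- Let p be a prime number, n ≥ 1 an integer, and A a commutative ring which is p-adically complete (the canonical map A → lim_k A/p^kA is bijective) and in which p is not a zero divisor. Then the set of p-th powers of elements of 1 + p^{n+1}A equals 1 + p^{n+2}A; that is: (i) (1 + p^{n+1}x)^p ∈ 1 + p^{n+2}A for every x ∈ A, and (ii) for every a ∈ A there exists v ∈ 1 + p^{n+1}A with v^p = 1 + p^{n+2}a. -/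
theorem fix_aux {A : Type*} [CommRing A] (t : A)
    (hcomp : IsAdicComplete (Ideal.span {t}) A) (g : Polynomial A) (a : A) :
    ∃ x : A, x + t * g.eval x = a := by
  let F : A → A := fun y => a - t * g.eval y
  have hF : ∀ (k : ℕ) (x y : A), t ^ k ∣ x - y → t ^ (k + 1) ∣ F x - F y := by
    intro k x y h
    have h1 : F x - F y = t * (g.eval y - g.eval x) := by simp only [F]; ring
    rw [h1, pow_succ']
    refine mul_dvd_mul_left _ ((?_ : t ^ k ∣ y - x).trans (Polynomial.sub_dvd_eval_sub _ _ _))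
    rwa [dvd_sub_comm]
  let u : ℕ → A := fun k => F^[k] 0
  have hu : ∀ k, u (k + 1) = F (u k) := fun k => Function.iterate_succ_apply' F k 0
  have hs : ∀ k, t ^ k ∣ u (k + 1) - u k := by
    intro k
    induction k with
    | zero => simp
    | succ k ih => rw [hu (k + 1), hu k]; rw [hu k] at ih; exact hF k _ _ ih
  have hs2 : ∀ m d, t ^ m ∣ u (m + d) - u m := by
    intro m d
    induction d with
    | zero => simp
    | succ d ih =>
      have := dvd_add ((pow_dvd_pow t (Nat.le_add_right m d)).trans (hs (m + d))) ih
      simpa [add_assoc] using this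
  have key : ∀ (k : ℕ) (x y : A),
      x ≡ y [SMOD (Ideal.span {t} ^ k • ⊤ : Submodule A A)] ↔ t ^ k ∣ x - y := by
    intro k x y
    rw [SModEq.sub_mem, smul_eq_mul, Ideal.mul_top, Ideal.span_singleton_pow,
      Ideal.mem_span_singleton]
  obtain ⟨L, hL⟩ := hcomp.toIsPrecomplete.prec' u (by
    intro m k hmk
    obtain ⟨d, rfl⟩ := Nat.exists_eq_add_of_le hmk
    rw [key, dvd_sub_comm]
    exact hs2 m d)
  refine ⟨L, ?_⟩
  have h0 : F L - L = 0 := by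
    refine hcomp.toIsHausdorff.haus' _ fun k => ?_
    rw [key, sub_zero]
    have h1 := (key k _ _).1 (hL k)
    have h2 := (pow_dvd_pow t (Nat.le_succ k)).trans (hF k _ _ h1)
    have h3 := (pow_dvd_pow t (Nat.le_succ k)).trans ((key (k + 1) _ _).1 (hL (k + 1)))
    rw [hu] at h3
    have := dvd_sub h3 h2
    simpa using this
  simp only [F] at h0
  linear_combination -h0

/-- The 'in particular' clause of Lemma 3.2 (logexp) of the paper:
`(1 + p^{n+1}A)^p = 1 + p^{n+2}A` in a `p`-adically complete ring `A` in which `p` is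
not a zero divisor, for `n ≥ 1`. -/
theorem stmt3 (p : ℕ) (hp : p.Prime) (n : ℕ) (hn : 1 ≤ n)
    (A : Type*) [CommRing A]
    (hcomp : IsAdicComplete (Ideal.span {(p : A)}) A)
    (hreg : (p : A) ∈ nonZeroDivisors A) :
    -- (i) every p-th power of an element of 1 + p^{n+1}A lies in 1 + p^{n+2}A
    (∀ x : A, (1 + (p : A) ^ (n + 1) * x) ^ p - 1 ∈ Ideal.span {(p : A) ^ (n + 2)}) ∧
    -- (ii) every element of 1 + p^{n+2}A is the p-th power of an element of 1 + p^{n+1}A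
    (∀ a : A, ∃ v : A, v - 1 ∈ Ideal.span {(p : A) ^ (n + 1)} ∧
      v ^ p = 1 + (p : A) ^ (n + 2) * a) := by
  obtain ⟨m, rfl⟩ := Nat.exists_eq_add_of_le' hn
  obtain ⟨k, hk⟩ := Polynomial.powAddExpansion (1 : Polynomial A)
    (Polynomial.C ((p : A) ^ (m + 1 + 1)) * Polynomial.X) p
  have hev : ∀ x : A, (1 + (p : A) ^ (m + 1 + 1) * x) ^ p = 1 + (p : A) ^ (m + 1 + 2) *
      (x + p * (Polynomial.C ((p : A) ^ m) * k * Polynomial.X ^ 2).eval x) := by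
    intro x
    have := congrArg (Polynomial.eval x) hk
    simp only [Polynomial.eval_pow, Polynomial.eval_add, Polynomial.eval_mul, Polynomial.eval_one,
      Polynomial.eval_C, Polynomial.eval_X, Polynomial.eval_natCast, one_pow] at this ⊢
    rw [this]
    ring
  constructor
  · intro x
    rw [hev, add_sub_cancel_left, Ideal.mem_span_singleton]
    exact dvd_mul_right _ _
  · intro a
    obtain ⟨x, hx⟩ := fix_aux (p : A) hcomp (Polynomial.C ((p : A) ^ m) * k * Polynomial.X ^ 2) a
    refine ⟨1 + (p : A) ^ (m + 1 + 1) * x, ?_, ?_⟩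
    · rw [add_sub_cancel_left, Ideal.mem_span_singleton]
      exact dvd_mul_right _ _
    · rw [hev, hx]
end

section
/- Let p be a prime number and n ≥ 1 an integer. Let R be a commutative Noetherian ring in which p is not a zero divisor, let R̂ = lim_k R/p^kR denote its p-adic completion, and assume that the canonical ring map R → R̂ is injective and that every element of R̂ which is integral over the image of R lies in the image of R (R is integrally closed in its p-adic completion). Then for every a ∈ R there exists v ∈ R with v − 1 ∈ p^{n+1}R and v^p = 1 + p^{n+2}a. Consequently the set of p-th powers of elements of 1 + p^{n+1}R equals 1 + p^{n+2}R. -/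
open Polynomial in
theorem aux_poly (p n : ℕ) (hn : 1 ≤ n) (R : Type*) [CommRing R] :
    ∃ g : R[X], (1 + (p : R[X]) ^ (n + 1) * X) ^ p
      = 1 + (p : R[X]) ^ (n + 2) * (X + (p : R[X]) * g) := by
  obtain ⟨k, hk⟩ := Polynomial.powAddExpansion (1 : R[X]) ((p : R[X]) ^ (n + 1) * X) p
  obtain ⟨m, rfl⟩ : ∃ m, n = m + 1 := ⟨n - 1, by omega⟩
  refine ⟨(p : R[X]) ^ m * X ^ 2 * k, ?_⟩
  rw [hk]
  simp only [one_pow, mul_one]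
  ring

open Polynomial in
theorem aux_root (p : ℕ) (R : Type*) [CommRing R] (g : R[X]) (a : R) :
    ∃ y : AdicCompletion (Ideal.span {(p : R)}) R,
      y + (p : AdicCompletion (Ideal.span {(p : R)}) R) * aeval y g
        = algebraMap R (AdicCompletion (Ideal.span {(p : R)}) R) a := by
  let f : ℕ → R := fun k => Nat.rec 0 (fun _ y => a - (p : R) * g.eval y) k
  have hs : ∀ k, f (k + 1) = a - (p : R) * g.eval (f k) := fun k => rfl
  have hd : ∀ k, (p : R) ^ k ∣ f k - f (k + 1) := by
    intro k
    induction k with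
    | zero => simp
    | succ k ih =>
      have h1 : f (k + 1) - f (k + 1 + 1)
          = (p : R) * (g.eval (f (k + 1)) - g.eval (f k)) := by
        rw [hs (k + 1), hs k]; ring
      rw [h1, pow_succ']
      refine mul_dvd_mul_left _ (dvd_trans ?_ (Polynomial.sub_dvd_eval_sub _ _ g))
      rw [← dvd_neg, neg_sub]; exact ih
  let c : AdicCompletion.AdicCauchySequence (Ideal.span {(p : R)}) R :=
    AdicCompletion.AdicCauchySequence.mk _ _ f (fun k => by
      rw [SModEq.sub_mem, smul_eq_mul, Ideal.mul_top, Ideal.span_singleton_pow,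
        Ideal.mem_span_singleton]
      exact hd k)
  refine ⟨AdicCompletion.mk _ _ c, AdicCompletion.ext_evalₐ fun k => ?_⟩
  have hc : AdicCompletion.evalₐ (Ideal.span {(p : R)}) k (AdicCompletion.mk _ _ c)
      = algebraMap R _ (f k) := AdicCompletion.evalₐ_mk _ _ _
  rw [map_add, map_mul, map_natCast, ← Polynomial.aeval_algHom_apply, hc,
    Polynomial.aeval_algebraMap_apply, AlgHom.commutes, ← map_natCast (algebraMap R (R ⧸ (Ideal.span {(p : R)}) ^ k)) p,
    ← map_mul, ← map_add]
  refine (Ideal.Quotient.mk_eq_mk_iff_sub_mem _ _).2 ?_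
  rw [Ideal.span_singleton_pow, Ideal.mem_span_singleton]
  convert hd k using 1
  rw [hs k, Polynomial.coe_aeval_eq_eval]; ring

/-- Affine-local content of Proposition 3.4 (logexp2) of the paper: if `R` is a
Noetherian commutative ring in which `p` is a non-zero-divisor, which embeds in its
`p`-adic completion `R̂ = lim_k R/p^kR` and is integrally closed in it, then for `n ≥ 1`
every element of `1 + p^{n+2}R` is the `p`-th power of an element of `1 + p^{n+1}R`;
consequently `(1 + p^{n+1}R)^p = 1 + p^{n+2}R`. -/
theorem stmt4 (p : ℕ) (hp : p.Prime) (n : ℕ) (hn : 1 ≤ n)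
    (R : Type*) [CommRing R] [IsNoetherianRing R]
    (hreg : (p : R) ∈ nonZeroDivisors R)
    (hinj : Function.Injective
      (algebraMap R (AdicCompletion (Ideal.span {(p : R)}) R)))
    (hic : ∀ x : AdicCompletion (Ideal.span {(p : R)}) R, IsIntegral R x →
      ∃ r : R, algebraMap R (AdicCompletion (Ideal.span {(p : R)}) R) r = x) :
    (∀ a : R, ∃ v : R, v - 1 ∈ Ideal.span {(p : R) ^ (n + 1)} ∧
      v ^ p = 1 + (p : R) ^ (n + 2) * a) ∧
    (∀ x : R, (1 + (p : R) ^ (n + 1) * x) ^ p - 1 ∈ Ideal.span {(p : R) ^ (n + 2)}) := by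
  obtain ⟨g, hg⟩ := aux_poly p n hn R
  constructor
  · intro a
    obtain ⟨y, hy⟩ := aux_root p R g a
    have h := congrArg (Polynomial.aeval y) hg
    simp only [map_pow, map_add, map_mul, map_one, map_natCast, Polynomial.aeval_X] at h
    rw [hy] at h
    obtain ⟨v, hv⟩ := hic (1 + (p : AdicCompletion (Ideal.span {(p : R)}) R) ^ (n + 1) * y) (by
      refine IsIntegral.of_pow hp.pos ?_
      rw [h]
      have : IsIntegral R (algebraMap R (AdicCompletion (Ideal.span {(p : R)}) R)
        (1 + (p : R) ^ (n + 2) * a)) := isIntegral_algebraMap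
      simpa only [map_pow, map_add, map_mul, map_one, map_natCast] using this)
    refine ⟨v, ?_, hinj ?_⟩
    · have h2 := congrArg (AdicCompletion.evalₐ (Ideal.span {(p : R)}) (n + 1)) hv
      have h0 : (p : R ⧸ (Ideal.span {(p : R)}) ^ (n + 1)) ^ (n + 1) = 0 := by
        rw [← map_natCast (Ideal.Quotient.mk _), ← map_pow, Ideal.Quotient.eq_zero_iff_mem]
        exact Ideal.pow_mem_pow (Ideal.mem_span_singleton_self _) _
      rw [AlgHom.commutes, map_add, map_mul, map_pow, map_natCast, h0, zero_mul, add_zero,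
        map_one] at h2
      rw [← Ideal.span_singleton_pow, ← Ideal.Quotient.eq_zero_iff_mem, map_sub, map_one]
      exact sub_eq_zero.2 h2
    · rw [map_pow, hv, h]
      simp only [map_pow, map_add, map_mul, map_one, map_natCast]
  · intro x
    have h := congrArg (Polynomial.eval x) hg
    simp only [Polynomial.eval_pow, Polynomial.eval_add, Polynomial.eval_mul,
      Polynomial.eval_one, Polynomial.eval_natCast, Polynomial.eval_X] at h
    rw [h, add_sub_cancel_left]
    exact Ideal.mul_mem_right _ _ (Ideal.mem_span_singleton_self _)
end

section
/- Let p be a prime number and P a finitely generated abelian group. Let (P_n)_{n≥1} be a decreasing sequence of subgroups of P (that is, P_{n+1} ⊆ P_n for all n) such that p^{n−1}P ⊆ P_n for every n ≥ 1. Let L denote the inverse limit lim_n P/P_n, realized as the subgroup of the product Π_{n≥1} P/P_n consisting of sequences (x_n) with x_n the image of x_{n+1} under the natural projection P/P_{n+1} → P/P_n for all n, and let Δ : P → L be the diagonal homomorphism. Then the quotient group L/Δ(P) is p-divisible: for every y ∈ L there exist z ∈ L and a ∈ P such that y = p·z + Δ(a). -/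
theorem aux_finite {P : Type*} [AddCommGroup P] [AddGroup.FG P] (Q : AddSubgroup P)
    (k : ℕ) (hk : 0 < k) (h : ∀ x : P, k • x ∈ Q) : Finite (P ⧸ Q) := by
  have : AddGroup.FG (P ⧸ Q) := QuotientAddGroup.fg Q
  apply AddCommGroup.finite_of_fg_isAddTorsion
  intro x
  induction x using QuotientAddGroup.induction_on with
  | H x =>
    rw [isOfFinAddOrder_iff_nsmul_eq_zero]
    refine ⟨k, hk, ?_⟩
    rw [← QuotientAddGroup.mk_nsmul]
    exact (QuotientAddGroup.eq_zero_iff _).2 (h x)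

open CategoryTheory in
theorem aux_lim (S : ℕ → Type*) [∀ n, Finite (S n)] [∀ n, Nonempty (S n)]
    (f : ∀ n, S (n + 1) → S n) : ∃ s : ∀ n, S n, ∀ n, f n (s (n + 1)) = s n := by
  let F : ℕᵒᵖ ⥤ Type _ := Functor.ofOpSequence (X := S) (fun n => TypeCat.ofHom (f n))
  have : ∀ j : ℕᵒᵖ, Finite (F.obj j) := fun j => inferInstanceAs (Finite (S j.unop))
  have : ∀ j : ℕᵒᵖ, Nonempty (F.obj j) := fun j => inferInstanceAs (Nonempty (S j.unop))
  obtain ⟨s, hs⟩ := nonempty_sections_of_finite_inverse_system F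
  refine ⟨fun n => s (Opposite.op n), fun n => ?_⟩
  have := hs (homOfLE (Nat.le_add_right n 1)).op
  rw [Functor.ofOpSequence_map_homOfLE_succ] at this
  exact this

/-- Key abelian-group computation in the paper's proof that `lim¹ Pic(X_n)` is
`p`-divisible: if `P` is a finitely generated abelian group and `(P_n)_{n≥1}` a
decreasing sequence of subgroups with `p^{n-1}P ⊆ P_n`, then `(lim_n P/P_n)/P` is
`p`-divisible. -/
theorem stmt5 (p : ℕ) (hp : p.Prime)
    (P : Type*) [AddCommGroup P] [AddGroup.FG P]
    (Pn : ℕ → AddSubgroup P)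
    (hdec : ∀ n : ℕ, 1 ≤ n → Pn (n + 1) ≤ Pn n)
    (hpow : ∀ n : ℕ, 1 ≤ n → ∀ x : P, p ^ (n - 1) • x ∈ Pn n) :
    ∀ y : (n : ℕ) → P ⧸ Pn n,
      (∀ n : ℕ, ∀ hn : 1 ≤ n,
        QuotientAddGroup.map (Pn (n + 1)) (Pn n) (AddMonoidHom.id P)
          (fun x hx => hdec n hn hx) (y (n + 1)) = y n) →
      ∃ z : (n : ℕ) → P ⧸ Pn n,
        (∀ n : ℕ, ∀ hn : 1 ≤ n,
          QuotientAddGroup.map (Pn (n + 1)) (Pn n) (AddMonoidHom.id P)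
            (fun x hx => hdec n hn hx) (z (n + 1)) = z n) ∧
        ∃ a : P, ∀ n : ℕ, 1 ≤ n →
          y n = p • z n + QuotientAddGroup.mk' (Pn n) a := by
  intro y hy
  have hfin : ∀ n, Finite (P ⧸ Pn (n + 1)) := fun n =>
    aux_finite _ (p ^ n) (pow_pos hp.pos n) (fun x => hpow (n + 1) (by omega) x)
  have hfp : Finite (P ⧸ (nsmulAddMonoidHom (α := P) p).range) :=
    aux_finite _ p hp.pos (fun x => ⟨x, rfl⟩)
  choose x hx using fun n => QuotientAddGroup.mk_surjective (y n)
  have hstep : ∀ n, 1 ≤ n → ∀ m, n ≤ m → (x m - x n ∈ Pn n ∧ Pn m ≤ Pn n) := by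
    intro n hn m hm
    induction m, hm using Nat.le_induction with
    | base => simp
    | succ m hm ih =>
      have h1 := hy m (hn.trans hm)
      rw [← hx, ← hx] at h1
      replace h1 : (QuotientAddGroup.mk (x (m + 1)) : P ⧸ Pn m) = QuotientAddGroup.mk (x m) := h1
      rw [eq_comm, QuotientAddGroup.eq] at h1
      refine ⟨?_, (hdec m (hn.trans hm)).trans ih.2⟩
      have h2 := (Pn n).add_mem (ih.2 h1) ih.1
      convert h2 using 1
      abel
  obtain ⟨c, hc⟩ := Finite.exists_infinite_fiber
    (fun n => (QuotientAddGroup.mk (x n) : P ⧸ (nsmulAddMonoidHom (α := P) p).range))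
  rw [Set.infinite_coe_iff] at hc
  obtain ⟨m0, hm0⟩ := hc.nonempty
  let S : ℕ → Type _ := fun n =>
    {z : P ⧸ Pn (n + 1) // y (n + 1) = p • z + QuotientAddGroup.mk' (Pn (n + 1)) (x m0)}
  have : ∀ n, Finite (S n) := fun n => Subtype.finite
  have : ∀ n, Nonempty (S n) := by
    intro n
    obtain ⟨m, hm, hnm⟩ := hc.exists_gt (n + 1)
    have h1 := (hm0 : _ = c).trans (hm : _ = c).symm
    simp only [QuotientAddGroup.eq] at h1
    obtain ⟨w, hw⟩ := h1
    refine ⟨⟨QuotientAddGroup.mk w, ?_⟩⟩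
    rw [← hx, ← QuotientAddGroup.mk_nsmul, QuotientAddGroup.mk'_apply, ← QuotientAddGroup.mk_add,
      QuotientAddGroup.eq]
    have h2 := (hstep (n + 1) (by omega) m hnm.le).1
    have hw2 : p • w = -x m0 + x m := hw
    rw [hw2]
    convert h2 using 1
    abel
  obtain ⟨s, hs⟩ := aux_lim S (fun n z =>
    ⟨QuotientAddGroup.map (Pn (n + 1 + 1)) (Pn (n + 1)) (AddMonoidHom.id P)
          (fun x hx => hdec (n + 1) (by omega) hx) z.1, by
      have h1 := hy (n + 1) (by omega)
      obtain ⟨z, hz⟩ := z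
      rw [hz, map_add, map_nsmul] at h1
      exact h1.symm⟩)
  refine ⟨fun n => match n with
    | 0 => 0
    | n + 1 => (s n).1, ?_, x m0, ?_⟩
  · rintro (_ | n) hn
    · omega
    · exact congrArg Subtype.val (hs n)
  · rintro (_ | n) hn
    · omega
    · exact (s n).2
end

section
/- Let K be a field of characteristic zero, D a finite-dimensional K-vector space, and φ : D → D a bijective K-linear endomorphism. Let F : ℤ → {subspaces of D} be a decreasing filtration with F(i) = D for all sufficiently small i and F(i) = 0 for all sufficiently large i, and let B be a symmetric bilinear form on D satisfying B(φx, φy) = B(x, y) for all x, y and such that F(i) = { x ∈ D : B(x, y) = 0 for all y ∈ F(1−i) } for every i ∈ ℤ. Assume: (a) T := φ + φ⁻¹ maps F(1) into F(1); (b) ker((φ − id)²) = ker(φ − id); (c) F(0) ∩ ker(φ − id) = 0. Let M ⊆ D be a subspace with φ(M) ⊆ M on which the restriction of B is nondegenerate. Then φ − id is injective on M, and the endomorphism of D/M induced by φ has no nonzero fixed vector. -/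
/-- Abstract linear-algebra form of the paper's Theorem 1.3 (mainth), case `k = 𝔽_p`:
under the autoduality, filtration-stability and semi-simplicity hypotheses of
Proposition 1.1, a φ-stable subspace `M` on which the form stays nondegenerate satisfies
`M^{φ=1} = 0` and `(D/M)^{φ=1} = 0`. -/
theorem stmt9 (K : Type*) [Field K] [CharZero K]
    (D : Type*) [AddCommGroup D] [Module K D] [FiniteDimensional K D]
    (φ : D ≃ₗ[K] D)
    (F : ℤ → Submodule K D)
    (hFdec : ∀ i : ℤ, F (i + 1) ≤ F i)
    (hFbot : ∃ i₀ : ℤ, ∀ i ≥ i₀, F i = ⊥)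
    (hFtop : ∃ i₁ : ℤ, ∀ i ≤ i₁, F i = ⊤)
    (B : D →ₗ[K] D →ₗ[K] K)
    (hBsymm : ∀ x y : D, B x y = B y x)
    (hBφ : ∀ x y : D, B (φ x) (φ y) = B x y)
    (hdual : ∀ i : ℤ, ∀ x : D, x ∈ F i ↔ ∀ y ∈ F (1 - i), B x y = 0)
    (hT : ∀ x ∈ F 1, φ x + φ.symm x ∈ F 1)
    (hss : LinearMap.ker ((φ.toLinearMap - LinearMap.id) ∘ₗ (φ.toLinearMap - LinearMap.id))
        = LinearMap.ker (φ.toLinearMap - LinearMap.id))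
    (hF0 : F 0 ⊓ LinearMap.ker (φ.toLinearMap - LinearMap.id) = ⊥)
    (M : Submodule K D) (hφM : ∀ x ∈ M, φ x ∈ M)
    (hMnd : ∀ x ∈ M, (∀ y ∈ M, B x y = 0) → x = 0) :
    (∀ x ∈ M, φ x = x → x = 0) ∧
    (∀ y : D ⧸ M, Submodule.mapQ M M φ.toLinearMap (fun a ha => hφM a ha) y = y →
      y = 0) := by
  have hF10 : F 1 ≤ F 0 := by simpa using hFdec 0
  have hker : ∀ v : D, v ∈ F 0 → φ v = v → v = 0 := by
    intro v hv hfix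
    have h : v ∈ F 0 ⊓ LinearMap.ker (φ.toLinearMap - LinearMap.id) :=
      ⟨hv, by simp [LinearMap.mem_ker, hfix]⟩
    rw [hF0] at h
    simpa using h
  have key : ∀ v : D, φ v = v → v = 0 := by
    intro v hv
    apply hker v _ hv
    rw [hdual 0]
    intro f hf
    have hf1 : f ∈ F 1 := by simpa using hf
    let N : D →ₗ[K] D := φ.toLinearMap + φ.symm.toLinearMap - (2 : K) • LinearMap.id
    have hN : ∀ x, N x = φ x + φ.symm x - (2 : K) • x := fun x => rfl
    have hNF : ∀ x ∈ F 1, N x ∈ F 1 := fun x hx =>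
      (F 1).sub_mem (hT x hx) ((F 1).smul_mem _ hx)
    have hinj : Function.Injective (N.restrict hNF) := by
      rw [injective_iff_map_eq_zero]
      rintro ⟨x, hx⟩ h
      have h0 : N x = 0 := congrArg Subtype.val h
      have h1 : φ (N x) = 0 := by rw [h0, map_zero]
      rw [hN, map_sub, map_add, map_smul, LinearEquiv.apply_symm_apply] at h1
      have h2 : x ∈ LinearMap.ker
          ((φ.toLinearMap - LinearMap.id) ∘ₗ (φ.toLinearMap - LinearMap.id)) := by
        rw [LinearMap.mem_ker]
        simp only [LinearMap.comp_apply, LinearMap.sub_apply, LinearMap.id_apply,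
          LinearEquiv.coe_coe, map_sub]
        rw [← h1, two_smul]
        abel
      rw [hss, LinearMap.mem_ker] at h2
      have h3 : φ x = x := by simpa [sub_eq_zero] using h2
      exact Subtype.ext (hker x (hF10 hx) h3)
    obtain ⟨g, hg⟩ := LinearMap.injective_iff_surjective.mp hinj ⟨f, hf1⟩
    have hg' : N g = f := congrArg Subtype.val hg
    have e1 : B v (φ g) = B v g := by
      have := hBφ v g
      rwa [hv] at this
    have e2 : B v (φ.symm g) = B v g := by
      have := hBφ v (φ.symm g)
      rw [hv, LinearEquiv.apply_symm_apply] at this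
      exact this.symm
    rw [← hg', hN, map_sub, map_add, map_smul, e1, e2, two_smul]
    abel
  refine ⟨fun x _ hx => key x hx, ?_⟩
  intro y
  obtain ⟨y, rfl⟩ := Submodule.Quotient.mk_surjective M y
  intro hy
  rw [Submodule.mapQ_apply, Submodule.Quotient.eq] at hy
  let P : D →ₗ[K] D := φ.toLinearMap - LinearMap.id
  have hP : ∀ x, P x = φ x - x := fun x => rfl
  have hPM : ∀ x ∈ M, P x ∈ M := fun x hx => M.sub_mem (hφM x hx) hx
  have hinj : Function.Injective (P.restrict hPM) := by
    rw [injective_iff_map_eq_zero]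
    rintro ⟨x, hx⟩ h
    have h0 : P x = 0 := congrArg Subtype.val h
    exact Subtype.ext (key x (sub_eq_zero.mp h0))
  obtain ⟨m, hm⟩ := LinearMap.injective_iff_surjective.mp hinj ⟨_, hy⟩
  have hm' : P m = P y := congrArg Subtype.val hm
  have h4 : y - (m : D) = 0 := by
    apply key
    rw [← sub_eq_zero, ← hP, map_sub, hm', sub_self]
  rw [Submodule.Quotient.mk_eq_zero, sub_eq_zero.mp h4]
  exact m.2
end
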